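/- Let ξ be a 3-dimensional subspace of ℝ⁷ admitting an orthonormal basis e₁, e₂, e₃ with φ₀(e₁,e₂,e₃) = 1 (an associative 3-plane). Then ξ is closed under the cross product: for all u, w ∈ ξ one has u × w ∈ ξ. -/

import Mathlib

noncomputable section
open scoped RealInnerProductSpace

abbrev E7 := EuclideanSpace ℝ (Fin 7)

/-- `dxⁱ ∧ dxʲ ∧ dxᵏ` evaluated on `(x, y, z)` (indices 0-based). -/
def d3 (i j k : Fin 7) (x y z : E7) : ℝ :=
  Matrix.det !![x i, x j, x k; y i, y j, y k; z i, z j, z k]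

/-- `dxⁱ ∧ dxʲ ∧ dxᵏ ∧ dxˡ` evaluated on `(x, y, z, w)` (indices 0-based). -/
def d4 (i j k l : Fin 7) (x y z w : E7) : ℝ :=
  Matrix.det !![x i, x j, x k, x l; y i, y j, y k, y l;
                z i, z j, z k, z l; w i, w j, w k, w l]

/-- The associative 3-form
`φ₀ = dx¹²³ + dx¹⁴⁵ − dx¹⁶⁷ + dx²⁴⁶ + dx²⁵⁷ + dx³⁴⁷ − dx³⁵⁶` (1-based indices; here 0-based). -/
def phi (x y z : E7) : ℝ :=
  d3 0 1 2 x y z + d3 0 3 4 x y z - d3 0 5 6 x y z + d3 1 3 5 x y z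
    + d3 1 4 6 x y z + d3 2 3 6 x y z - d3 2 4 5 x y z

/-- The coassociative 4-form
`ψ₀ = dx⁴⁵⁶⁷ + dx²³⁶⁷ − dx²³⁴⁵ + dx¹³⁵⁷ + dx¹³⁴⁶ + dx¹²⁵⁶ − dx¹²⁴⁷` (1-based; here 0-based). -/
def psi (x y z w : E7) : ℝ :=
  d4 3 4 5 6 x y z w + d4 1 2 5 6 x y z w - d4 1 2 3 4 x y z w + d4 0 2 4 6 x y z w
    + d4 0 2 3 5 x y z w + d4 0 1 4 5 x y z w - d4 0 1 3 6 x y z w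

theorem d3_expand (i j k : Fin 7) (x y z : E7) :
    d3 i j k x y z = x i * (y j * z k - y k * z j) - x j * (y i * z k - y k * z i)
      + x k * (y i * z j - y j * z i) := by
  simp only [d3, Matrix.det_fin_three]
  simp
  ring

theorem phi_cyc (x y z : E7) : phi y z x = phi x y z := by
  simp only [phi, d3_expand]
  ring

theorem d3_comb (i j k : Fin 7) (p q r z : E7) (a b : Fin 3 → ℝ) :
    d3 i j k (a 0 • p + a 1 • q + a 2 • r) (b 0 • p + b 1 • q + b 2 • r) z
      = (a 0 * b 1 - a 1 * b 0) * d3 i j k p q z + (a 1 * b 2 - a 2 * b 1) * d3 i j k q r z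
        + (a 2 * b 0 - a 0 * b 2) * d3 i j k r p z := by
  simp only [d3_expand, PiLp.add_apply, PiLp.smul_apply, smul_eq_mul]
  ring

theorem phi_comb (p q r z : E7) (a b : Fin 3 → ℝ) :
    phi (a 0 • p + a 1 • q + a 2 • r) (b 0 • p + b 1 • q + b 2 • r) z
      = (a 0 * b 1 - a 1 * b 0) * phi p q z + (a 1 * b 2 - a 2 * b 1) * phi q r z
        + (a 2 * b 0 - a 0 * b 2) * phi r p z := by
  simp only [phi, d3_comb]
  ring

theorem cross_coord (cross : E7 → E7 → E7)
    (hcross : ∀ x y z : E7, ⟪cross x y, z⟫ = phi x y z) (x y : E7) (i : Fin 7) :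
    cross x y i = phi x y (EuclideanSpace.single i 1) := by
  rw [← hcross]
  simp [EuclideanSpace.inner_single_right]

/-- The norm identity for the cross product. -/
theorem cross_inner_self (cross : E7 → E7 → E7)
    (hcross : ∀ x y z : E7, ⟪cross x y, z⟫ = phi x y z) (x y : E7) :
    ⟪cross x y, cross x y⟫ = ⟪x, x⟫ * ⟪y, y⟫ - ⟪x, y⟫ ^ 2 := by
  have h := cross_coord cross hcross x y
  simp only [PiLp.inner_apply, Fin.sum_univ_seven, h]
  simp [phi, d3_expand, EuclideanSpace.single_apply]
  ring

theorem cross_eq_of_phi (cross : E7 → E7 → E7)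
    (hcross : ∀ x y z : E7, ⟪cross x y, z⟫ = phi x y z) (x y z : E7)
    (hx : ⟪x, x⟫ = 1) (hy : ⟪y, y⟫ = 1) (hz : ⟪z, z⟫ = 1) (hxy : ⟪x, y⟫ = 0)
    (h : phi x y z = 1) : cross x y = z := by
  have h1 := cross_inner_self cross hcross x y
  have h2 := hcross x y z
  rw [← sub_eq_zero, ← inner_self_eq_zero (𝕜 := ℝ), inner_sub_sub_self,
    real_inner_comm (cross x y) z, h1, h2, h, hx, hy, hz, hxy]
  norm_num

/-- an associative 3-plane is closed under the cross product
(defined by `⟨x×y, z⟩ = φ₀(x,y,z)`). -/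
theorem associative_plane_closed_under_cross
    (cross : E7 → E7 → E7)
    (hcross : ∀ x y z : E7, ⟪cross x y, z⟫ = phi x y z)
    (ξ : Submodule ℝ E7) (hdim : Module.finrank ℝ ξ = 3)
    (e : Fin 3 → E7) (hmem : ∀ i, e i ∈ ξ) (horth : Orthonormal ℝ e)
    (hcal : phi (e 0) (e 1) (e 2) = 1) :
    ∀ u ∈ ξ, ∀ w ∈ ξ, cross u w ∈ ξ := by
  have hspan : Submodule.span ℝ (Set.range e) = ξ := by
    apply Submodule.eq_of_le_of_finrank_eq
    · rw [Submodule.span_le]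
      rintro _ ⟨i, rfl⟩
      exact hmem i
    · rw [finrank_span_eq_card horth.linearIndependent, hdim, Fintype.card_fin]
  have hn : ∀ i, ⟪e i, e i⟫ = 1 := fun i => by
    rw [real_inner_self_eq_norm_sq, horth.1 i, one_pow]
  have c01 := cross_eq_of_phi cross hcross (e 0) (e 1) (e 2) (hn 0) (hn 1) (hn 2)
    (horth.2 (by decide)) hcal
  have c12 := cross_eq_of_phi cross hcross (e 1) (e 2) (e 0) (hn 1) (hn 2) (hn 0)
    (horth.2 (by decide)) (by rw [phi_cyc, hcal])
  have c20 := cross_eq_of_phi cross hcross (e 2) (e 0) (e 1) (hn 2) (hn 0) (hn 1)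
    (horth.2 (by decide)) (by rw [phi_cyc, phi_cyc, hcal])
  intro u hu w hw
  rw [← hspan, Submodule.mem_span_range_iff_exists_fun] at hu hw
  obtain ⟨a, rfl⟩ := hu
  obtain ⟨b, rfl⟩ := hw
  simp only [Fin.sum_univ_three]
  have key : cross (a 0 • e 0 + a 1 • e 1 + a 2 • e 2) (b 0 • e 0 + b 1 • e 1 + b 2 • e 2)
      = (a 0 * b 1 - a 1 * b 0) • e 2 + (a 1 * b 2 - a 2 * b 1) • e 0
        + (a 2 * b 0 - a 0 * b 2) • e 1 := by
    apply ext_inner_right ℝ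
    intro z
    rw [hcross, phi_comb, ← hcross, ← hcross, ← hcross, c01, c12, c20]
    simp only [inner_add_left, real_inner_smul_left]
  rw [key]
  exact ξ.add_mem (ξ.add_mem (ξ.smul_mem _ (hmem 2)) (ξ.smul_mem _ (hmem 0)))
    (ξ.smul_mem _ (hmem 1))
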